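/- If p is a prime and d ≡ 1 (mod p−1), then p divides W_p; that is, p ∈ P_{d,c} for every integer c. -/

import Mathlib

/-- `W d c n = φ^n(0)` where `φ(x) = x^d + c`. -/
def W (d : ℕ) (c : ℤ) (n : ℕ) : ℤ := (fun x : ℤ => x ^ d + c)^[n] 0

/-- `D_{d,c} = {n : n ≥ 1 and n ∣ W_n}`. -/
def Dset (d : ℕ) (c : ℤ) : Set ℕ := {n | 1 ≤ n ∧ (n : ℤ) ∣ W d c n}

/-- `P_{d,c}` is the set of primes in `D_{d,c}`. -/
def Pset (d : ℕ) (c : ℤ) : Set ℕ := {p ∈ Dset d c | p.Prime}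

theorem mem_P_of_deg_cong_one (d : ℕ) (hd : 2 ≤ d) (c : ℤ) (p : ℕ) (hp : p.Prime)
    (hcong : (p - 1) ∣ (d - 1)) :
    (p : ℤ) ∣ W d c p ∧ p ∈ Pset d c := by
  haveI : Fact p.Prime := ⟨hp⟩
  have hpow : ∀ x : ZMod p, x ^ d = x := by
    intro x
    obtain ⟨k, hk⟩ := hcong
    have hd' : d = (p - 1) * k + 1 := by omega
    rw [hd', pow_succ, pow_mul]
    by_cases hx : x = 0
    · simp [hx]
    · rw [ZMod.pow_card_sub_one_eq_one hx, one_pow, one_mul]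
  have hW : ∀ n : ℕ, ((W d c n : ℤ) : ZMod p) = (n : ZMod p) * (c : ZMod p) := by
    intro n
    induction n with
    | zero => simp [W]
    | succ m ih =>
      have h : W d c (m + 1) = W d c m ^ d + c := by
        unfold W
        rw [Function.iterate_succ_apply']
      rw [h]
      push_cast
      rw [hpow, ih]
      ring
  have hdvd : (p : ℤ) ∣ W d c p := by
    rw [← ZMod.intCast_zmod_eq_zero_iff_dvd, hW]
    simp
  exact ⟨hdvd, ⟨hp.one_lt.le, hdvd⟩, hp⟩
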